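/- arXiv:2209.09998 — 2 statements merged into one kernel-verified Lean document; each statement's English description precedes it below -/
import Mathlib

section
/- Let λ₀, μ₀, ω, ξ, q_P, q_S ∈ ℂ with σ₀ := λ₀ + 2μ₀, and suppose ω² = σ₀·(q_P² + ξ²) and ω² = μ₀·(q_S² + ξ²). Let P = diag(μ₀, σ₀), N = [[0, −λ₀], [μ₀, 0]], a₁ = [[−ξ, i q_S], [i q_P, −ξ]], a₂ = [[−ξ, −i q_S], [−i q_P, −ξ]], and define the matrix-valued functions U₁(Z) = a₁·diag(e^{i q_P Z}, e^{i q_S Z}) and U₂(Z) = a₂·diag(e^{−i q_P Z}, e^{−i q_S Z}), with derivatives taken entrywise in Z. Then for every Z the Wronskian W(Z) := U₂(Z)ᵀ·P·U₁′(Z) − (U₂ᵀ)′(Z)·P·U₁(Z) + ξ·U₂(Z)ᵀ·(N − Nᵀ)·U₁(Z) equals the constant matrix 2·i·ω²·diag(q_P, q_S). -/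
open Matrix

/-- The entrywise derivative of `t ↦ a * diag(e^{c t}, e^{d t})`. -/
lemma deriv_mul_diagonal_exp (a : Matrix (Fin 2) (Fin 2) ℂ) (c d Z : ℂ) :
    (Matrix.of fun i j => deriv (fun t : ℂ =>
        (a * Matrix.diagonal ![Complex.exp (c * t), Complex.exp (d * t)]) i j) Z)
      = a * Matrix.diagonal ![c * Complex.exp (c * Z), d * Complex.exp (d * Z)] := by
  have hexp (b k : ℂ) :
      deriv (fun t : ℂ => b * Complex.exp (k * t)) Z = b * (k * Complex.exp (k * Z)) := by
    have h := (((hasDerivAt_id Z).const_mul k).cexp).const_mul b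
    simpa [mul_comm] using h.deriv
  ext i j
  fin_cases j <;> simp [Matrix.mul_diagonal, hexp, -deriv_const_mul_field']

/-- The Wronskian W_{1,2} of the explicit matrix Jost solutions of the Rayleigh
system in a homogeneous half space equals the constant 2iω²·diag(q_P, q_S). -/
theorem rayleigh_wronskian
    (lam₀ μ₀ ω ξ qP qS σ₀ : ℂ)
    (hσ : σ₀ = lam₀ + 2 * μ₀)
    (hωP : ω^2 = σ₀ * (qP^2 + ξ^2))
    (hωS : ω^2 = μ₀ * (qS^2 + ξ^2))
    (P N a₁ a₂ : Matrix (Fin 2) (Fin 2) ℂ)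
    (hP : P = !![μ₀, 0; 0, σ₀])
    (hN : N = !![0, -lam₀; μ₀, 0])
    (ha₁ : a₁ = !![-ξ, Complex.I * qS; Complex.I * qP, -ξ])
    (ha₂ : a₂ = !![-ξ, -Complex.I * qS; -Complex.I * qP, -ξ])
    (U₁ U₂ : ℂ → Matrix (Fin 2) (Fin 2) ℂ)
    (hU₁ : U₁ = fun Z => a₁ *
      Matrix.diagonal ![Complex.exp (Complex.I * qP * Z), Complex.exp (Complex.I * qS * Z)])
    (hU₂ : U₂ = fun Z => a₂ *
      Matrix.diagonal ![Complex.exp (-Complex.I * qP * Z), Complex.exp (-Complex.I * qS * Z)]) :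
    ∀ Z : ℂ,
      (U₂ Z)ᵀ * P * (Matrix.of fun i j => deriv (fun t => U₁ t i j) Z)
        - (Matrix.of fun i j => deriv (fun t => U₂ t i j) Z)ᵀ * P * U₁ Z
        + ξ • ((U₂ Z)ᵀ * (N - Nᵀ) * U₁ Z)
      = Matrix.diagonal ![2 * Complex.I * ω^2 * qP, 2 * Complex.I * ω^2 * qS] := by
  intro Z
  subst hU₁ hU₂
  simp only [deriv_mul_diagonal_exp]
  subst hP hN ha₁ ha₂
  have hlam : lam₀ = σ₀ - 2 * μ₀ := by rw [hσ]; ring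
  have eP : Complex.exp (-Complex.I * qP * Z) * Complex.exp (Complex.I * qP * Z) = 1 := by
    rw [← Complex.exp_add, ← Complex.exp_zero]; congr 1; ring
  have eS : Complex.exp (-Complex.I * qS * Z) * Complex.exp (Complex.I * qS * Z) = 1 := by
    rw [← Complex.exp_add, ← Complex.exp_zero]; congr 1; ring
  have hI : Complex.I ^ 2 = -1 := Complex.I_sq
  generalize Complex.exp (-Complex.I * qP * Z) = p' at *
  generalize Complex.exp (Complex.I * qP * Z) = p at *
  generalize Complex.exp (-Complex.I * qS * Z) = s' at *
  generalize Complex.exp (Complex.I * qS * Z) = s at *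
  generalize Complex.I = I at *
  clear hσ
  subst hlam
  ext i j
  fin_cases i <;> fin_cases j <;>
    simp [Matrix.mul_apply, Fin.sum_univ_two, Matrix.vecMul_diagonal]
  all_goals grind
end

section
/- Let ω > 0 and μ₀ > 0, set c = ω²/μ₀, and define q_S(ξ) = i·√(ξ² − c) using the principal branch of the complex square root. Let K_{S,+} = {ξ ∈ ℂ : Re ξ > 0} \ {x ∈ ℝ : 0 < x ≤ √c} (the open right half-plane with the real interval (0, √c] removed), and let ℂ₊ = {w ∈ ℂ : Im w > 0}. Then q_S is holomorphic on K_{S,+} and maps K_{S,+} bijectively onto ℂ₊. -/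
theorem Complex.cpow_two_inv_re_pos {z : ℂ} (hz : z ∈ Complex.slitPlane) :
    0 < (z ^ (2⁻¹ : ℂ)).re := by
  rw [Complex.cpow_inv_two_re]
  apply Real.sqrt_pos.2
  rcases Complex.mem_slitPlane_iff.1 hz with h | h
  · linarith [norm_nonneg z]
  · linarith [Complex.abs_re_lt_norm.2 h, neg_abs_le z.re]

theorem Complex.sq_mem_slitPlane {v : ℂ} (hv : 0 < v.re) : v ^ 2 ∈ Complex.slitPlane := by
  rw [Complex.mem_slitPlane_iff]
  by_cases h : v.im = 0
  · left
    simp only [sq, Complex.mul_re, h]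
    nlinarith
  · right
    simp only [sq, Complex.mul_im]
    intro h2
    exact mul_ne_zero hv.ne' h (by linarith)

theorem Complex.add_ofReal_mem_slitPlane {z : ℂ} (hz : z ∈ Complex.slitPlane) {c : ℝ}
    (hc : 0 ≤ c) : z + c ∈ Complex.slitPlane := by
  rw [Complex.mem_slitPlane_iff] at hz ⊢
  simp only [Complex.add_re, Complex.add_im, Complex.ofReal_re, Complex.ofReal_im, add_zero]
  exact hz.imp_left fun h => by linarith

/-- A point of the right half-plane avoids the cut `(0, √c]` exactly when `ξ² - c` avoids the
branch cut of the principal square root. -/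
theorem Complex.sq_sub_mem_slitPlane_iff {c : ℝ} {ξ : ℂ} (hξ : 0 < ξ.re) :
    ξ ^ 2 - c ∈ Complex.slitPlane ↔ ¬(ξ.im = 0 ∧ 0 < ξ.re ∧ ξ.re ≤ Real.sqrt c) := by
  rw [Complex.mem_slitPlane_iff, Real.le_sqrt' hξ]
  simp only [sq, Complex.sub_re, Complex.sub_im, Complex.mul_re, Complex.mul_im,
    Complex.ofReal_re, Complex.ofReal_im, sub_zero]
  by_cases h : ξ.im = 0
  · simp [h, hξ]
  · have : ξ.re * ξ.im ≠ 0 := mul_ne_zero hξ.ne' h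
    simp only [h, false_and, not_false_eq_true, iff_true]
    exact Or.inr fun h2 => this (by linarith)

/-- The S-quasimomentum q_S(ξ) = i√(ξ² − ω²/μ₀) is holomorphic on the physical
sheet K_{S,+} (the open right half-plane with the real cut (0, ω/√μ₀] removed)
and maps it conformally (bijectively) onto the upper half-plane. -/
theorem qS_conformal_physical_sheet
    (ω μ₀ : ℝ) (hω : 0 < ω) (hμ : 0 < μ₀)
    (c : ℝ) (hc : c = ω^2 / μ₀)
    (qS : ℂ → ℂ)
    (hqS : qS = fun ξ : ℂ => Complex.I * (ξ^2 - (c : ℂ)) ^ ((1 : ℂ)/2))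
    (K : Set ℂ)
    (hK : K = {ξ : ℂ | 0 < ξ.re} \
      {ξ : ℂ | ξ.im = 0 ∧ 0 < ξ.re ∧ ξ.re ≤ Real.sqrt c}) :
    DifferentiableOn ℂ qS K ∧ Set.BijOn qS K {w : ℂ | 0 < w.im} := by
  have hc0 : 0 ≤ c := by rw [hc]; positivity
  have mem_K (ξ : ℂ) : ξ ∈ K ↔ 0 < ξ.re ∧ ξ ^ 2 - c ∈ Complex.slitPlane := by
    rw [hK]
    exact and_congr_right fun h => (Complex.sq_sub_mem_slitPlane_iff h).symm
  have sq_root (z : ℂ) : (z ^ (2⁻¹ : ℂ)) ^ 2 = z := by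
    exact Complex.cpow_nat_inv_pow z two_ne_zero
  simp only [one_div] at hqS
  subst hqS
  refine ⟨?_, ?_, ?_, ?_⟩
  · intro ξ hξ
    have hbase : DifferentiableAt ℂ (fun ξ : ℂ => ξ ^ 2 - (c : ℂ)) ξ := by fun_prop
    exact ((hbase.cpow (differentiableAt_const _) ((mem_K ξ).1 hξ).2).const_mul
      _).differentiableWithinAt
  · intro ξ hξ
    simpa using Complex.cpow_two_inv_re_pos ((mem_K ξ).1 hξ).2
  · intro ξ hξ η hη h
    have h1 := congrArg (· ^ 2) (mul_left_cancel₀ Complex.I_ne_zero h)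
    simp only [sq_root, sub_left_inj] at h1
    rw [← Complex.sq_cpow_two_inv ((mem_K ξ).1 hξ).1, h1,
      Complex.sq_cpow_two_inv ((mem_K η).1 hη).1]
  · intro w hw
    have hv : 0 < (-Complex.I * w).re := by simpa using hw
    have hv2 := Complex.sq_mem_slitPlane hv
    refine ⟨((-Complex.I * w) ^ 2 + c) ^ (2⁻¹ : ℂ), (mem_K _).2 ⟨?_, ?_⟩, ?_⟩
    · exact Complex.cpow_two_inv_re_pos (Complex.add_ofReal_mem_slitPlane hv2 hc0)
    · rwa [sq_root, add_sub_cancel_right]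
    · simp only [sq_root, add_sub_cancel_right]
      rw [Complex.sq_cpow_two_inv hv, ← mul_assoc, mul_neg, Complex.I_mul_I, neg_neg, one_mul]
end
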